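/- arXiv:2412.19025 — 8 statements merged into one kernel-verified Lean document; each statement's English description precedes it below -/
import Mathlib

section
/- Fix ρ ∈ (0, 1/2) and θ ∈ [0, 1/2]. Let S := {(a, b) ∈ [0,1] × [0,1] : (1 − (ρ*θ)) a + (ρ*θ)(1 − b) = ρ} and define f(a, b) := (1−ρ)((1−θ)a + θ(1−b)) + ρ(θ(1−a) + (1−θ)b). Then the pair (0, (1−2ρ)θ/(ρ*θ)) belongs to S, f(0, (1−2ρ)θ/(ρ*θ)) = 2(1−ρ)ρθ/(ρ*θ), and f(a, b) ≥ 2(1−ρ)ρθ/(ρ*θ) for every (a, b) ∈ S. Consequently the minimum of f over S equals 2(1−ρ)ρθ/(ρ*θ). -/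
/-- Binary convolution: `p*q := (1−p)q + p(1−q)`. -/
def bconv (p q : ℝ) : ℝ := (1 - p) * q + p * (1 - q)

theorem stmt_1 (ρ θ : ℝ) (hρ : ρ ∈ Set.Ioo (0:ℝ) (1/2)) (hθ : θ ∈ Set.Icc (0:ℝ) (1/2))
    (S : Set (ℝ × ℝ))
    (hS : S = {ab : ℝ × ℝ | ab.1 ∈ Set.Icc (0:ℝ) 1 ∧ ab.2 ∈ Set.Icc (0:ℝ) 1 ∧
      (1 - bconv ρ θ) * ab.1 + bconv ρ θ * (1 - ab.2) = ρ})
    (f : ℝ × ℝ → ℝ)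
    (hf : f = fun ab => (1 - ρ) * ((1 - θ) * ab.1 + θ * (1 - ab.2))
      + ρ * (θ * (1 - ab.1) + (1 - θ) * ab.2)) :
    ((0:ℝ), (1 - 2*ρ) * θ / bconv ρ θ) ∈ S ∧
    f ((0:ℝ), (1 - 2*ρ) * θ / bconv ρ θ) = 2 * (1 - ρ) * ρ * θ / bconv ρ θ ∧
    (∀ ab ∈ S, 2 * (1 - ρ) * ρ * θ / bconv ρ θ ≤ f ab) ∧
    IsLeast (f '' S) (2 * (1 - ρ) * ρ * θ / bconv ρ θ) := by
  obtain ⟨h0, h1⟩ := hρ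
  obtain ⟨t0, t1⟩ := hθ
  have hc : 0 < bconv ρ θ := by unfold bconv; nlinarith
  have hcd : bconv ρ θ = (1 - ρ) * θ + ρ * (1 - θ) := rfl
  generalize bconv ρ θ = c at *
  have m : ((0:ℝ), (1 - 2*ρ) * θ / c) ∈ S := by
    rw [hS]
    refine ⟨⟨le_refl _, zero_le_one⟩, ⟨?_, ?_⟩, ?_⟩
    · exact div_nonneg (mul_nonneg (by linarith) t0) hc.le
    · show (1 - 2*ρ) * θ / c ≤ 1
      rw [div_le_one hc]; nlinarith
    · show (1 - c) * 0 + c * (1 - (1 - 2*ρ) * θ / c) = ρ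
      field_simp
      rw [hcd]; ring
  have e : f ((0:ℝ), (1 - 2*ρ) * θ / c) = 2 * (1 - ρ) * ρ * θ / c := by
    rw [hf]
    show (1 - ρ) * ((1 - θ) * 0 + θ * (1 - (1 - 2*ρ) * θ / c))
      + ρ * (θ * (1 - 0) + (1 - θ) * ((1 - 2*ρ) * θ / c)) = _
    field_simp
    rw [hcd]; ring
  have l : ∀ ab ∈ S, 2 * (1 - ρ) * ρ * θ / c ≤ f ab := by
    rintro ⟨a, b⟩ h
    rw [hS] at h
    obtain ⟨⟨ha, -⟩, -, h⟩ := h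
    simp only at ha h
    rw [hf, div_le_iff₀ hc]
    have k : 0 ≤ 2 * ρ * (1 - ρ) * (1 - 2 * θ) * a :=
      mul_nonneg (mul_nonneg (mul_nonneg (by linarith) (by linarith)) (by linarith)) ha
    subst hcd
    simp only
    linear_combination k + (ρ - θ) * h
  refine ⟨m, e, l, ⟨_, m, e⟩, ?_⟩
  rintro _ ⟨x, hx, rfl⟩
  exact l x hx
end

section
/- Fix θ ∈ (0, 1/2], δ₁ ∈ [0, 1/2], and δ₂ ∈ [0, θ]. Let S := {(α, β) ∈ [0,1] × [0,1] : (1 − (δ₁*θ)) α + (δ₁*θ) β = δ₁*δ₂} and define G(α, β) := (1 − δ₁ − θ)(1 − 2δ₂) α − (δ₁ − θ)(1 − 2δ₂) β + (δ₁*δ₂). Then the pair (0, (δ₁*δ₂)/(δ₁*θ)) belongs to S, G(0, (δ₁*δ₂)/(δ₁*θ)) = 2(δ₁*δ₂)((1 − δ₁ − δ₂)θ + δ₁δ₂)/(δ₁*θ), and G(α, β) ≥ 2(δ₁*δ₂)((1 − δ₁ − δ₂)θ + δ₁δ₂)/(δ₁*θ) for every (α, β) ∈ S. Consequently the minimum of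 G over S equals 2(δ₁*δ₂)((1 − δ₁ − δ₂)θ + δ₁δ₂)/(δ₁*θ). -/
theorem stmt_2 (θ δ₁ δ₂ : ℝ) (hθ : θ ∈ Set.Ioc (0:ℝ) (1/2))
    (hδ₁ : δ₁ ∈ Set.Icc (0:ℝ) (1/2)) (hδ₂ : δ₂ ∈ Set.Icc (0:ℝ) θ)
    (S : Set (ℝ × ℝ))
    (hS : S = {ab : ℝ × ℝ | ab.1 ∈ Set.Icc (0:ℝ) 1 ∧ ab.2 ∈ Set.Icc (0:ℝ) 1 ∧
      (1 - bconv δ₁ θ) * ab.1 + bconv δ₁ θ * ab.2 = bconv δ₁ δ₂})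
    (G : ℝ × ℝ → ℝ)
    (hG : G = fun ab => (1 - δ₁ - θ) * (1 - 2*δ₂) * ab.1
      - (δ₁ - θ) * (1 - 2*δ₂) * ab.2 + bconv δ₁ δ₂) :
    ((0:ℝ), bconv δ₁ δ₂ / bconv δ₁ θ) ∈ S ∧
    G ((0:ℝ), bconv δ₁ δ₂ / bconv δ₁ θ)
      = 2 * bconv δ₁ δ₂ * ((1 - δ₁ - δ₂) * θ + δ₁ * δ₂) / bconv δ₁ θ ∧
    (∀ ab ∈ S, 2 * bconv δ₁ δ₂ * ((1 - δ₁ - δ₂) * θ + δ₁ * δ₂) / bconv δ₁ θ ≤ G ab) ∧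
    IsLeast (G '' S) (2 * bconv δ₁ δ₂ * ((1 - δ₁ - δ₂) * θ + δ₁ * δ₂) / bconv δ₁ θ) := by
  obtain ⟨h0, h1⟩ := hθ
  obtain ⟨h2, h3⟩ := hδ₁
  obtain ⟨h4, h5⟩ := hδ₂
  have hc : 0 < bconv δ₁ θ := by unfold bconv; nlinarith
  have hd : 0 ≤ bconv δ₁ δ₂ := by unfold bconv; nlinarith
  have hdc : bconv δ₁ δ₂ ≤ bconv δ₁ θ := by unfold bconv; nlinarith
  have A : ((0:ℝ), bconv δ₁ δ₂ / bconv δ₁ θ) ∈ S := by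
    rw [hS]
    refine ⟨⟨le_refl _, zero_le_one⟩, ⟨div_nonneg hd hc.le, (div_le_one hc).2 hdc⟩, ?_⟩
    simp only [mul_zero, zero_add]
    exact mul_div_cancel₀ _ hc.ne'
  have B : G ((0:ℝ), bconv δ₁ δ₂ / bconv δ₁ θ)
      = 2 * bconv δ₁ δ₂ * ((1 - δ₁ - δ₂) * θ + δ₁ * δ₂) / bconv δ₁ θ := by
    rw [hG, eq_div_iff hc.ne']
    have e : bconv δ₁ δ₂ / bconv δ₁ θ * bconv δ₁ θ = bconv δ₁ δ₂ := div_mul_cancel₀ _ hc.ne'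
    have e2 : bconv δ₁ θ = (1 - δ₁) * θ + δ₁ * (1 - θ) := rfl
    simp only
    linear_combination (-(δ₁ - θ) * (1 - 2*δ₂)) * e + bconv δ₁ δ₂ * e2
  have C : ∀ ab ∈ S,
      2 * bconv δ₁ δ₂ * ((1 - δ₁ - δ₂) * θ + δ₁ * δ₂) / bconv δ₁ θ ≤ G ab := by
    rw [hS, hG]
    rintro ⟨a, b⟩ ⟨⟨ha, -⟩, -, hab⟩
    simp only at ha hab ⊢
    rw [div_le_iff₀ hc]
    have e2 : bconv δ₁ θ = (1 - δ₁) * θ + δ₁ * (1 - θ) := rfl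
    have key : 0 ≤ a * (1 - 2*δ₂) * (2 * δ₁ * (1 - δ₁) * (1 - 2*θ)) := by
      have : 0 ≤ 1 - 2*δ₂ := by linarith
      have : 0 ≤ 1 - δ₁ := by linarith
      have : 0 ≤ 1 - 2*θ := by linarith
      positivity
    have e3 : ((1 - δ₁ - θ) * (1 - 2*δ₂) * a - (δ₁ - θ) * (1 - 2*δ₂) * b + bconv δ₁ δ₂)
        * bconv δ₁ θ = 2 * bconv δ₁ δ₂ * ((1 - δ₁ - δ₂) * θ + δ₁ * δ₂)
        + a * (1 - 2*δ₂) * (2 * δ₁ * (1 - δ₁) * (1 - 2*θ)) := by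
      linear_combination (-(δ₁ - θ) * (1 - 2*δ₂)) * hab
        + (bconv δ₁ δ₂ + a * (1 - 2*δ₂) * (1 - 2*δ₁)) * e2
    rw [e3]
    linarith
  refine ⟨A, B, C, ⟨_, A, B⟩, ?_⟩
  rintro _ ⟨x, hx, rfl⟩
  exact C x hx
end

section
/- For every θ ∈ (0, 1/2], the function ψ(δ) := H_b(δ*θ) − H_b(δ) is strictly decreasing on the interval [0, 1/2]. -/
/-- The base-2 binary entropy function (with the convention `H_b(0) = H_b(1) = 0`,
which holds automatically since `Real.logb 2 0 = 0`). -/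
noncomputable def binEnt (p : ℝ) : ℝ := -p * Real.logb 2 p - (1 - p) * Real.logb 2 (1 - p)

theorem binEnt_eq_aux (p : ℝ) : binEnt p = Real.binEntropy p / Real.log 2 := by
  simp only [binEnt, Real.binEntropy, Real.logb, Real.log_inv]
  ring

theorem nat_version (θ : ℝ) (h0 : 0 < θ) (h1 : θ ≤ 1/2) :
    StrictAntiOn (fun δ : ℝ => Real.binEntropy (bconv δ θ) - Real.binEntropy δ)
      (Set.Icc (0:ℝ) (1/2)) := by
  apply strictAntiOn_of_deriv_neg (convex_Icc _ _)
  · apply Continuous.continuousOn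
    unfold bconv
    fun_prop
  · intro δ hδ
    rw [interior_Icc] at hδ
    obtain ⟨hd0, hd1⟩ := hδ
    have hc1 : δ < bconv δ θ := by unfold bconv; nlinarith
    have hc2 : bconv δ θ ≤ 1/2 := by unfold bconv; nlinarith
    have hb : HasDerivAt (fun x => bconv x θ) (1 - 2 * θ) δ := by
      have h := ((hasDerivAt_id δ).mul_const (1 - 2 * θ)).const_add θ
      have e : (fun x => bconv x θ) = fun x => θ + id x * (1 - 2 * θ) := by
        funext x; simp only [bconv, id]; ring
      rw [e]
      rwa [one_mul] at h
    have hE := (Real.hasDerivAt_binEntropy (p := bconv δ θ) (by linarith) (by linarith)).comp δ hb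
    have hD := Real.hasDerivAt_binEntropy (p := δ) (by linarith) (by linarith)
    have hF := hE.sub hD
    have hd : deriv (fun δ : ℝ => Real.binEntropy (bconv δ θ) - Real.binEntropy δ) δ = _ := hF.deriv
    rw [hd]
    have a1 : Real.log δ < Real.log (bconv δ θ) := Real.log_lt_log hd0 hc1
    have a2 : Real.log (1 - bconv δ θ) < Real.log (1 - δ) :=
      Real.log_lt_log (by linarith) (by linarith)
    have a3 : Real.log (bconv δ θ) ≤ Real.log (1 - bconv δ θ) :=
      Real.log_le_log (by linarith) (by linarith)
    nlinarith [mul_nonneg h0.le (sub_nonneg.2 a3)]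

theorem stmt_3 (θ : ℝ) (hθ : θ ∈ Set.Ioc (0:ℝ) (1/2)) :
    StrictAntiOn (fun δ : ℝ => binEnt (bconv δ θ) - binEnt δ) (Set.Icc (0:ℝ) (1/2)) := by
  intro a ha b hb hab
  have h := nat_version θ hθ.1 hθ.2 ha hb hab
  simp only [binEnt_eq_aux, ← sub_div] at h ⊢
  exact div_lt_div_of_pos_right h (Real.log_pos (by norm_num))
end

section
/- Let ρ ∈ (0, 1/2) and let θ satisfy ρ²/(2ρ² − 2ρ + 1) ≤ θ < 1/2. Then for every δ ∈ [0, ρ), one has 2(1−δ)δθ/(δ*θ) < 2(1−ρ)ρθ/(ρ*θ). -/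
theorem stmt_5 (ρ θ : ℝ) (hρ : ρ ∈ Set.Ioo (0:ℝ) (1/2))
    (hθ₁ : ρ^2 / (2*ρ^2 - 2*ρ + 1) ≤ θ) (hθ₂ : θ < 1/2) :
    ∀ δ ∈ Set.Ico 0 ρ,
      2 * (1 - δ) * δ * θ / bconv δ θ < 2 * (1 - ρ) * ρ * θ / bconv ρ θ := by
  rintro δ ⟨h0, h1⟩
  obtain ⟨r0, r1⟩ := hρ
  have hq : 0 < 2*ρ^2 - 2*ρ + 1 := by nlinarith [sq_nonneg (2*ρ - 1)]
  have ht : 0 < θ := lt_of_lt_of_le (by positivity) hθ₁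
  rw [div_le_iff₀ hq] at hθ₁
  have hk : 0 < 1 - 2*θ := by linarith
  have eδ : bconv δ θ = θ + δ * (1 - 2*θ) := by unfold bconv; ring
  have eρ : bconv ρ θ = θ + ρ * (1 - 2*θ) := by unfold bconv; ring
  rw [eδ, eρ, div_lt_div_iff₀ (by positivity) (by positivity)]
  have hd : 0 < ρ - δ := by linarith
  have h2 : 0 < (ρ - δ) * (θ + (1 - 2*θ) * ρ) := by positivity
  have h3 : 0 < θ * (1 - ρ - δ) - (1 - 2*θ) * ρ * δ := by nlinarith
  have h4 : 0 < 2 * θ * ((ρ - δ) * (θ * (1 - ρ - δ) - (1 - 2*θ) * ρ * δ)) := by positivity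
  nlinarith
end

section
/- Let Γ > 0, λ₁ > 0, λ₂ > 0 be reals and let m ≥ 1 be an integer. Define h(α) := 2(1 − √((1−α)Γ/((1−α)Γ + 1)))·λ₁ + 2m·(((1−α)Γ + 1)/(Γ + 1))^{1/m}·λ₂ for α in a neighborhood of 0. Then h is differentiable at α = 0 with h'(0) = √Γ·λ₁/(Γ+1)^{3/2} − 2Γλ₂/(Γ+1). -/
theorem stmt_9 (Γ lam₁ lam₂ : ℝ) (hΓ : 0 < Γ) (h₁ : 0 < lam₁) (h₂ : 0 < lam₂)
    (m : ℕ) (hm : 1 ≤ m) :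
    HasDerivAt (fun α : ℝ =>
        2 * (1 - Real.sqrt ((1 - α)*Γ / ((1 - α)*Γ + 1))) * lam₁
          + 2 * m * (((1 - α)*Γ + 1) / (Γ + 1)) ^ ((1:ℝ)/m) * lam₂)
      (Real.sqrt Γ * lam₁ / (Γ + 1) ^ ((3:ℝ)/2) - 2*Γ*lam₂ / (Γ + 1)) 0 := by
  have hm0 : (m : ℝ) ≠ 0 := by
    have : m ≠ 0 := by omega
    exact_mod_cast this
  have hp : 0 < Γ + 1 := by linarith
  have hu : HasDerivAt (fun α : ℝ => (1 - α) * Γ) (-Γ) 0 := by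
    have := ((hasDerivAt_id (0:ℝ)).const_sub 1).mul_const Γ
    simpa using this
  have hv : HasDerivAt (fun α : ℝ => (1 - α) * Γ + 1) (-Γ) 0 := hu.add_const 1
  have hv0 : (1 - (0:ℝ)) * Γ + 1 ≠ 0 := by
    rw [sub_zero, one_mul]; exact hp.ne'
  have hq := hu.fun_div hv hv0
  have hq0 : (1 - (0:ℝ)) * Γ / ((1 - (0:ℝ)) * Γ + 1) ≠ 0 := by
    rw [sub_zero, one_mul]; positivity
  have hs := hq.sqrt hq0
  have hw := hv.div_const (Γ + 1)
  have hw0 : ((1 - (0:ℝ)) * Γ + 1) / (Γ + 1) = 1 := by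
    rw [sub_zero, one_mul]; exact div_self hp.ne'
  have hr := hw.rpow_const (p := (1:ℝ)/m) (Or.inl (by rw [hw0]; exact one_ne_zero))
  have hfin := (((hs.const_sub 1).const_mul 2).mul_const lam₁).fun_add
    ((hr.const_mul (2 * (m:ℝ))).mul_const lam₂)
  refine hfin.congr_deriv ?_
  rw [hw0, Real.one_rpow]
  have h32 : (Γ + 1) ^ ((3:ℝ)/2) = (Γ + 1) * Real.sqrt (Γ + 1) := by
    rw [show (3:ℝ)/2 = 1 + 1/2 by norm_num, Real.rpow_add hp, Real.rpow_one,
      ← Real.sqrt_eq_rpow]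
  rw [h32, sub_zero, one_mul, Real.sqrt_div hΓ.le]
  have ha : 0 < Real.sqrt Γ := Real.sqrt_pos.2 hΓ
  have hb : 0 < Real.sqrt (Γ + 1) := Real.sqrt_pos.2 hp
  have ha2 := Real.sq_sqrt hΓ.le
  have hb2 := Real.sq_sqrt hp.le
  set a := Real.sqrt Γ
  set b := Real.sqrt (Γ + 1)
  rw [← hb2, ← ha2]
  have hab : b ^ 2 = a ^ 2 + 1 := by rw [hb2, ha2]
  field_simp
  rw [hab]
  ring
end

section
/- Let λ₁ > 0 be real and let L₁ ≥ 1 be an integer. Then lim_{Γ → 0⁺} (2L₁λ₁(Γ+1)^{−1/L₁} + 2√(Γ/(Γ+1))·λ₁ − 2L₁λ₁)/√Γ = 2λ₁. -/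
theorem stmt_10 (lam₁ : ℝ) (h₁ : 0 < lam₁) (L₁ : ℕ) (hL₁ : 1 ≤ L₁) :
    Filter.Tendsto
      (fun Γ : ℝ =>
        (2 * L₁ * lam₁ * (Γ + 1) ^ (-(1:ℝ)/L₁) + 2 * Real.sqrt (Γ / (Γ + 1)) * lam₁
          - 2 * L₁ * lam₁) / Real.sqrt Γ)
      (nhdsWithin 0 (Set.Ioi 0)) (nhds (2 * lam₁)) := by
  obtain ⟨c, hc⟩ : ∃ c, HasDerivAt (fun x : ℝ => x ^ (-(1:ℝ)/L₁)) c 1 :=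
    ⟨_, Real.hasDerivAt_rpow_const (Or.inl one_ne_zero)⟩
  have hs := (hasDerivAt_iff_tendsto_slope_zero.1 hc).mono_left
    (nhdsWithin_mono (0:ℝ) (s := Set.Ioi 0) (fun x hx => ne_of_gt hx))
  have hq : Filter.Tendsto (fun Γ : ℝ => Real.sqrt Γ) (nhdsWithin 0 (Set.Ioi 0)) (nhds 0) := by
    have : Filter.Tendsto (fun Γ : ℝ => Real.sqrt Γ) (nhds 0) (nhds (Real.sqrt 0)) :=
      Real.continuous_sqrt.tendsto 0
    rw [Real.sqrt_zero] at this
    exact this.mono_left nhdsWithin_le_nhds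
  have hr : Filter.Tendsto (fun Γ : ℝ => (Real.sqrt (Γ + 1))⁻¹)
      (nhdsWithin 0 (Set.Ioi 0)) (nhds 1) := by
    have : ContinuousAt (fun Γ : ℝ => (Real.sqrt (Γ + 1))⁻¹) 0 := by
      apply ContinuousAt.inv₀
      · fun_prop
      · simp
    have h := this.tendsto
    simp only [zero_add, Real.sqrt_one, inv_one] at h
    exact h.mono_left nhdsWithin_le_nhds
  have key := ((hq.mul hs).const_mul (2 * L₁ * lam₁)).add (hr.const_mul (2 * lam₁))
  simp only [zero_mul, mul_zero, zero_add, mul_one] at key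
  refine key.congr' ?_
  filter_upwards [self_mem_nhdsWithin] with x hx
  have hx : 0 < x := hx
  have hsx := Real.sqrt_pos.2 hx
  have hsx1 := Real.sqrt_pos.2 (show 0 < x + 1 by linarith)
  rw [Real.sqrt_div hx.le, Real.one_rpow, smul_eq_mul, add_comm 1 x]
  have e : √x * x⁻¹ = (√x)⁻¹ := by
    rw [← div_eq_mul_inv, Real.sqrt_div_self', one_div]
  rw [← mul_assoc (√x), e]
  generalize (x + 1) ^ (-(1:ℝ)/L₁) = y
  field_simp
  ring
end

section
/- Let μ_X, μ_Y ∈ ℝ, σ_X > 0, σ_Y > 0, and Γ ≥ 0. On a probability space, let X and N be independent random variables with X distributed N(μ_X, σ_X²) and N distributed N(0, 1). Define Y := (σ_Y/√(Γ+1))·((√Γ/σ_X)(X − μ_X) + N) + μ_Y. Then E[(X − Y)²] = (μ_X − μ_Y)² + σ_X² + σ_Y² − 2√(Γ/(Γ+1))·σ_X σ_Y. -/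
open MeasureTheory ProbabilityTheory

theorem stmt_14 {Ω : Type*} [MeasureSpace Ω] [IsProbabilityMeasure (ℙ : Measure Ω)]
    (μX μY σX σY Γ : ℝ) (hσX : 0 < σX) (hσY : 0 < σY) (hΓ : 0 ≤ Γ)
    (X N : Ω → ℝ) (hXm : Measurable X) (hNm : Measurable N)
    (hindep : IndepFun X N ℙ)
    (hX : Measure.map X ℙ = gaussianReal μX (Real.toNNReal (σX ^ 2)))
    (hN : Measure.map N ℙ = gaussianReal 0 1)
    (Y : Ω → ℝ)
    (hY : Y = fun ω =>
      σY / Real.sqrt (Γ + 1) * (Real.sqrt Γ / σX * (X ω - μX) + N ω) + μY) :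
    ∫ ω, (X ω - Y ω) ^ 2 ∂ℙ
      = (μX - μY) ^ 2 + σX ^ 2 + σY ^ 2 - 2 * Real.sqrt (Γ / (Γ + 1)) * σX * σY := by
  have hs : 0 < Real.sqrt (Γ + 1) := Real.sqrt_pos.mpr (by linarith)
  have hs2 : Real.sqrt (Γ + 1) ^ 2 = Γ + 1 := Real.sq_sqrt (by linarith)
  have hg2 : Real.sqrt Γ ^ 2 = Γ := Real.sq_sqrt hΓ
  rw [Real.sqrt_div hΓ]
  set s := Real.sqrt (Γ + 1)
  set g := Real.sqrt Γ
  have lX : HasLaw X (gaussianReal μX (Real.toNNReal (σX ^ 2))) ℙ := ⟨hXm.aemeasurable, hX⟩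
  have lN : HasLaw N (gaussianReal 0 1) ℙ := ⟨hNm.aemeasurable, hN⟩
  have mX : MemLp X 2 ℙ := by
    have h := memLp_id_gaussianReal' (μ := μX) (v := Real.toNNReal (σX ^ 2)) 2 (by simp)
    rw [← hX] at h
    exact h.comp_of_map hXm.aemeasurable
  have mN : MemLp N 2 ℙ := by
    have h := memLp_id_gaussianReal' (μ := 0) (v := 1) 2 (by simp)
    rw [← hN] at h
    exact h.comp_of_map hNm.aemeasurable
  have eX : ∫ ω, X ω ∂ℙ = μX := by rw [lX.integral_eq, integral_id_gaussianReal]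
  have eN : ∫ ω, N ω ∂ℙ = 0 := by rw [lN.integral_eq, integral_id_gaussianReal]
  have vX := variance_eq_sub mX
  have vN := variance_eq_sub mN
  rw [lX.variance_eq, variance_id_gaussianReal, eX, Real.coe_toNNReal _ (sq_nonneg _)] at vX
  rw [lN.variance_eq, variance_id_gaussianReal, eN] at vN
  have eX2 : ∫ ω, X ω ^ 2 ∂ℙ = σX ^ 2 + μX ^ 2 := by
    simp only [Pi.pow_apply] at vX; linarith
  have eN2 : ∫ ω, N ω ^ 2 ∂ℙ = 1 := by
    simp only [Pi.pow_apply] at vN; push_cast at vN; linarith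
  have eXN : ∫ ω, X ω * N ω ∂ℙ = 0 := by
    rw [hindep.integral_fun_mul_eq_mul_integral hXm.aestronglyMeasurable
      hNm.aestronglyMeasurable, eN, mul_zero]
  have iX := mX.integrable (by norm_num)
  have iN := mN.integrable (by norm_num)
  have iX2 := mX.integrable_sq
  have iN2 := mN.integrable_sq
  have iXN : Integrable (fun ω => X ω * N ω) ℙ := mX.integrable_mul mN
  have key : ∀ a b c : ℝ, ∫ ω, (a * X ω + b * N ω + c) ^ 2 ∂ℙ
      = a ^ 2 * (σX ^ 2 + μX ^ 2) + b ^ 2 + 2 * a * c * μX + c ^ 2 := by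
    intro a b c
    have : ∀ ω, (a * X ω + b * N ω + c) ^ 2 = a ^ 2 * X ω ^ 2 + b ^ 2 * N ω ^ 2
        + (2 * a * b) * (X ω * N ω) + (2 * a * c) * X ω + (2 * b * c) * N ω + c ^ 2 := by
      intro ω; ring
    simp_rw [this]
    rw [integral_add (by fun_prop) (by fun_prop), integral_add (by fun_prop) (by fun_prop),
      integral_add (by fun_prop) (by fun_prop), integral_add (by fun_prop) (by fun_prop),
      integral_add (by fun_prop) (by fun_prop)]
    simp only [integral_const_mul, eX2, eN2, eXN, eX, eN, integral_const, probReal_univ,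
      smul_eq_mul]
    ring
  have hZ : ∀ ω, X ω - Y ω = (1 - σY / s * (g / σX)) * X ω + (-(σY / s)) * N ω
      + (σY / s * (g / σX) * μX - μY) := by
    intro ω; rw [hY]; ring
  simp_rw [hZ]
  rw [key]
  have h1 : (σY / s) ^ 2 * (g ^ 2 + 1) = σY ^ 2 := by
    rw [hg2, ← hs2]; field_simp
  have h2 : g / σX * σX = g := by field_simp
  have h3 : g / s = (σY / s) * g / σY := by field_simp
  have h4 : 2 * (g / s) * σX * σY = 2 * (σY / s) * (g / σX * σX) * σX := by
    rw [h2]; ring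
  rw [h4, ← h1]
  generalize σY / s = c
  rw [← h2]
  generalize hq : g / σX * σX / σX = q
  have h5 : g / σX = q := by rw [← hq, h2]
  try rw [h5]
  ring
end

section
/- Let 𝒳 be a finite type with at least 2 elements, let p : 𝒳 → ℝ be a probability mass function with p(x) > 0 for all x, and let p_min := min_x p(x). For an integer k ≥ 0, define the kernel K_k(x' | x) := ((k+1)p(x) − p_min)/((k+1)p(x)) if x' = x, and K_k(x' | x) := p_min/((k+1)(|𝒳| − 1)p(x)) if x' ≠ x. Then: (i) K_k(x' | x) ≥ 0 for all x, x' and ∑_{x'} K_k(x' | x) = 1 for every x; (ii) ∑_x p(x) K_k(x' | x) = p(x') for every x'; (iii) ∑_x p(x) K_k(x | x) = 1 − |𝒳|·p_min/(k+1), which tends to 1 as k → ∞. -/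
open Filter

theorem stmt_15 {𝒳 : Type*} [Fintype 𝒳] [DecidableEq 𝒳] (hcard : 2 ≤ Fintype.card 𝒳)
    (p : 𝒳 → ℝ) (hp : ∀ x, 0 < p x) (hsum : ∑ x, p x = 1)
    (pmin : ℝ) (hpmin : IsLeast (Set.range p) pmin)
    (K : ℕ → 𝒳 → 𝒳 → ℝ)
    (hK : ∀ (k : ℕ) (x x' : 𝒳), K k x x' =
      if x' = x then (((k:ℝ) + 1) * p x - pmin) / (((k:ℝ) + 1) * p x)
      else pmin / (((k:ℝ) + 1) * ((Fintype.card 𝒳 : ℝ) - 1) * p x)) :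
    -- (i) each `K k (· | x)` is a probability mass function
    (∀ (k : ℕ) (x x' : 𝒳), 0 ≤ K k x x') ∧
    (∀ (k : ℕ) (x : 𝒳), ∑ x', K k x x' = 1) ∧
    -- (ii) `K k` preserves the distribution `p`
    (∀ (k : ℕ) (x' : 𝒳), ∑ x, p x * K k x x' = p x') ∧
    -- (iii) the probability of no change is `1 − |𝒳|·pmin/(k+1)`, tending to `1`
    (∀ k : ℕ, ∑ x, p x * K k x x = 1 - (Fintype.card 𝒳 : ℝ) * pmin / ((k:ℝ) + 1)) ∧
    Tendsto (fun k : ℕ => ∑ x, p x * K k x x) atTop (nhds 1) := by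
  have hite : ∀ (a : 𝒳) (A B : ℝ), ∑ x, (if x = a then A else B)
      = A + ((Fintype.card 𝒳 : ℝ) - 1) * B := by
    intro a A B
    have : ∀ x, (if x = a then A else B) = (if x = a then A - B else 0) + B := by
      intro x
      split_ifs <;> ring
    simp only [this, Finset.sum_add_distrib, Finset.sum_ite_eq', Finset.mem_univ, if_true,
      Finset.sum_const, Finset.card_univ, nsmul_eq_mul]
    ring
  have hn : (0:ℝ) < (Fintype.card 𝒳 : ℝ) - 1 := by
    have : (2:ℝ) ≤ (Fintype.card 𝒳 : ℝ) := by exact_mod_cast hcard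
    linarith
  obtain ⟨⟨x0, hx0⟩, hle⟩ := hpmin
  have hmin : 0 < pmin := hx0 ▸ hp x0
  have hle' : ∀ x, pmin ≤ p x := fun x => hle ⟨x, rfl⟩
  have hk : ∀ k : ℕ, (0:ℝ) < (k:ℝ) + 1 := fun k => by positivity
  have hmain : ∀ (k : ℕ) (x x' : 𝒳), p x * K k x x' =
      if x = x' then p x' - pmin / ((k:ℝ) + 1)
      else pmin / (((k:ℝ) + 1) * ((Fintype.card 𝒳 : ℝ) - 1)) := by
    intro k x x'
    have h1 := (hk k).ne'
    have h2 := (hp x).ne'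
    have h3 := hn.ne'
    rw [hK]
    by_cases h : x = x'
    · subst h
      simp only [if_true]
      field_simp
    · rw [if_neg h, if_neg (Ne.symm h)]
      field_simp
  have hdiag : ∀ k : ℕ, ∑ x, p x * K k x x
      = 1 - (Fintype.card 𝒳 : ℝ) * pmin / ((k:ℝ) + 1) := by
    intro k
    simp only [hmain, if_true, Finset.sum_sub_distrib, hsum, Finset.sum_const,
      Finset.card_univ, nsmul_eq_mul]
    ring
  refine ⟨?_, ?_, ?_, hdiag, ?_⟩
  · intro k x x'
    have h1 := hk k
    have h2 := hp x
    rw [hK]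
    split_ifs
    · apply div_nonneg _ (by positivity)
      have : (0:ℝ) ≤ k := Nat.cast_nonneg k
      nlinarith [hle' x, mul_nonneg this h2.le]
    · positivity
  · intro k x
    have h1 := (hk k).ne'
    have h2 := (hp x).ne'
    have h3 := hn.ne'
    simp only [hK]
    rw [hite]
    field_simp
    ring
  · intro k x'
    have h1 := (hk k).ne'
    have h3 := hn.ne'
    simp only [hmain]
    rw [hite]
    field_simp
    ring
  · simp only [hdiag]
    have h : Tendsto (fun k : ℕ => (Fintype.card 𝒳 : ℝ) * pmin * (1 / ((k:ℝ) + 1)))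
        atTop (nhds ((Fintype.card 𝒳 : ℝ) * pmin * 0)) :=
      tendsto_one_div_add_atTop_nhds_zero_nat.const_mul _
    have h' := h.const_sub 1
    simpa [div_eq_mul_inv] using h'
end
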